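/- arXiv:2009.11643 — 8 statements merged into one kernel-verified Lean document; each statement's English description precedes it below -/
import Mathlib

section
/- Let j ∈ ℕ, let α be an MD strategy, let i ∈ S be a state and m ∈ A(i) an available action. If the standard basis vector c_i does not lie in V₁^j, then M_α(w)·1 = M_{α^{i→m}}(w)·1 for all words w ∈ L* of length at most j. -/
open Matrix

/-- A labelled Markov decision process: a partial probabilistic transition function
`phi : S × A ⇀ (S → ℝ)` and a labelling function. -/
structure MDP (S A L : Type) where
  phi : S → A → Option (S → ℝ)
  label : S → L

namespace MDP

variable {S A L : Type} [Fintype S] [Fintype A] [DecidableEq S]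

/-- The MDP data is well-formed: every state has an available action, and every
defined `phi s m` is a probability distribution on `S`. -/
def IsValid (D : MDP S A L) : Prop :=
  (∀ s, ∃ m, (D.phi s m).isSome) ∧
    ∀ s m d, D.phi s m = some d → (∀ t, 0 ≤ d t) ∧ (∑ t, d t) = 1

/-- Transition probabilities, with `0` for unavailable actions. -/
def trans (D : MDP S A L) (s : S) (m : A) : S → ℝ :=
  (D.phi s m).getD 0

/-- A memoryless strategy: for each state a probability distribution on the
available actions. -/
def IsStrategy (D : MDP S A L) (α : S → A → ℝ) : Prop :=
  ∀ s, (∀ m, 0 ≤ α s m) ∧ (∑ m, α s m) = 1 ∧ ∀ m, D.phi s m = none → α s m = 0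

/-- Transition probabilities of the induced labelled Markov chain `D(α)`. -/
def tau (D : MDP S A L) (α : S → A → ℝ) (s t : S) : ℝ :=
  ∑ m, α s m * D.trans s m t

/-- The matrix `M_α(a)`. -/
def Mmat [DecidableEq L] (D : MDP S A L) (α : S → A → ℝ) (a : L) : Matrix S S ℝ :=
  Matrix.of fun s t => if D.label s = a then D.tau α s t else 0

/-- The matrix `M_α(w)` for a word `w ∈ L*` (identity for the empty word). -/
def Mword [DecidableEq L] (D : MDP S A L) (α : S → A → ℝ) (w : List L) : Matrix S S ℝ :=
  (w.map (D.Mmat α)).prod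

/-- A memoryless deterministic (MD) strategy, viewed as a function `S → A`
choosing an available action in each state. -/
def IsMD (D : MDP S A L) (β : S → A) : Prop := ∀ s, (D.phi s (β s)).isSome

/-- The memoryless strategy corresponding to an MD strategy. -/
def mdStrat [DecidableEq A] (β : S → A) : S → A → ℝ :=
  fun s m => if m = β s then 1 else 0

end MDP

namespace MDP

variable {S A L : Type} [Fintype S] [Fintype A] [Fintype L]
  [DecidableEq S] [DecidableEq A] [DecidableEq L]

/-- The column-vector space
`V₁^j = span{M_{α₁}(a₁)⋯M_{α_k}(a_k)·1 : k ≤ j, αᵢ memoryless strategies, aᵢ ∈ L}`. -/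
def V1le (D : MDP S A L) (j : ℕ) : Submodule ℝ (S → ℝ) :=
  Submodule.span ℝ
    {v | ∃ k : ℕ, k ≤ j ∧ ∃ (αs : Fin k → S → A → ℝ) (as : Fin k → L),
      (∀ i, D.IsStrategy (αs i)) ∧
      v = ((List.ofFn fun i => D.Mmat (αs i) (as i)).prod).mulVec 1}

end MDP

namespace MDP

variable {S A L : Type}

/-- `M_α(w)·1` lies in `V₁^j` for every memoryless strategy `α` and word `w` of length at
most `j`. -/
theorem mword_mulVec_one_mem_V1le [Fintype S] [Fintype A] [DecidableEq S]
    [DecidableEq L] (D : MDP S A L) {α : S → A → ℝ} (hα : D.IsStrategy α)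
    {j : ℕ} {w : List L} (hw : w.length ≤ j) :
    (D.Mword α w).mulVec 1 ∈ D.V1le j := by
  refine Submodule.subset_span ⟨w.length, hw, fun _ => α, w.get, fun _ => hα, ?_⟩
  have h : (List.ofFn fun i => D.Mmat α (w.get i)) = w.map (D.Mmat α) := by
    rw [← Function.comp_def, ← List.map_ofFn, List.ofFn_get]
  rw [Mword, h]

/-- The memoryless strategy corresponding to an MD strategy is a strategy. -/
theorem IsMD.isStrategy_mdStrat [Fintype A] [DecidableEq A] {D : MDP S A L}
    {β : S → A} (hβ : D.IsMD β) :
    D.IsStrategy (mdStrat β) := by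
  refine fun s => ⟨fun m => ?_, by simp [mdStrat], fun m hm => ?_⟩
  · unfold mdStrat
    split_ifs <;> norm_num
  · refine if_neg ?_
    rintro rfl
    simpa [hm] using hβ s

/-- Switching an MD strategy at one state to an available action yields an MD strategy. -/
theorem IsMD.update [DecidableEq S] {D : MDP S A L} {β : S → A} (hβ : D.IsMD β) {i : S} {m : A}
    (hm : (D.phi i m).isSome) : D.IsMD (Function.update β i m) := by
  intro s
  rcases eq_or_ne s i with rfl | h
  · simpa using hm
  · simpa [h] using hβ s

/-- Switching an MD strategy at state `i` affects only row `i` of `M_β(a)`. -/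
theorem mmat_update_mulVec_apply [Fintype S] [Fintype A] [DecidableEq S] [DecidableEq A]
    [DecidableEq L] (D : MDP S A L) (β : S → A) {i s : S} (h : s ≠ i) (m : A) (a : L) (v : S → ℝ) :
    (D.Mmat (mdStrat (Function.update β i m)) a).mulVec v s =
      (D.Mmat (mdStrat β) a).mulVec v s := by
  simp [Matrix.mulVec, dotProduct, Mmat, tau, mdStrat, h]

/-- Two vectors of a submodule that differ at most in coordinate `i` are equal unless the
submodule contains the standard basis vector at `i`. -/
theorem eq_of_single_notMem {ι K : Type*} [DecidableEq ι] [Field K]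
    {V : Submodule K (ι → K)} {i : ι} (hi : Pi.single i (1 : K) ∉ V) {x y : ι → K}
    (hx : x ∈ V) (hy : y ∈ V) (h : ∀ s, s ≠ i → x s = y s) : x = y := by
  have hxy : x - y = (x i - y i) • Pi.single i (1 : K) := by
    ext s
    rcases eq_or_ne s i with rfl | hs
    · simp
    · simp [hs, h s hs]
  have hmem := V.sub_mem hx hy
  rw [hxy] at hmem
  have h0 : x i - y i = 0 := by
    by_contra h0
    exact hi ((V.smul_mem_iff h0).1 hmem)
  rwa [h0, zero_smul, sub_eq_zero] at hxy

end MDP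

namespace MDP

variable {S A L : Type} [Fintype S] [Fintype A] [Fintype L]
  [DecidableEq S] [DecidableEq A] [DecidableEq L]

/-- if the standard basis vector `c_i` is not in `V₁^j`, then switching
the MD strategy `β` at state `i` to action `m` does not change `M_β(w)·1` for words of
length at most `j`. -/
theorem mword_mulVec_one_update
    (D : MDP S A L) (hD : D.IsValid) (j : ℕ)
    (β : S → A) (hβ : D.IsMD β) (i : S) (m : A) (hm : (D.phi i m).isSome)
    (hc : Pi.single i (1 : ℝ) ∉ D.V1le j) :
    ∀ w : List L, w.length ≤ j →
      (D.Mword (mdStrat β) w).mulVec 1 =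
        (D.Mword (mdStrat (Function.update β i m)) w).mulVec 1 := by
  intro w hw
  induction w with
  | nil => rfl
  | cons a u ih =>
    refine eq_of_single_notMem hc (D.mword_mulVec_one_mem_V1le hβ.isStrategy_mdStrat hw)
      (D.mword_mulVec_one_mem_V1le (hβ.update hm).isStrategy_mdStrat hw) fun s hs => ?_
    have hu := ih (Nat.le_of_succ_le hw)
    unfold Mword at hu ⊢
    rw [List.map_cons, List.map_cons, List.prod_cons, List.prod_cons, ← Matrix.mulVec_mulVec,
      ← Matrix.mulVec_mulVec, ← hu, mmat_update_mulVec_apply D β hs]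

end MDP
end

section
/- Let μ and ν be probability distributions on S. If there exist a memoryless strategy α and a word w ∈ L* with μ·M_α(w)·1 ≠ ν·M_α(w)·1, then there exist an MD strategy α' and a word w' ∈ L* of length at most |S|−1 with μ·M_{α'}(w')·1 ≠ ν·M_{α'}(w')·1. -/
open Matrix

namespace MDP

section ShortWord

variable {S L : Type} [Fintype S] [DecidableEq S]

/-- The vector `M(w)·1` for a family of matrices `M` and a word `w`. -/
def wordVec (M : L → Matrix S S ℝ) (w : List L) : S → ℝ :=
  (w.map M).prod.mulVec 1

@[simp]
theorem wordVec_nil (M : L → Matrix S S ℝ) : wordVec M [] = 1 := by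
  simp [wordVec]

theorem wordVec_append (M : L → Matrix S S ℝ) (u w : List L) :
    wordVec M (u ++ w) = (u.map M).prod *ᵥ wordVec M w := by
  simp [wordVec]

theorem wordVec_cons (M : L → Matrix S S ℝ) (a : L) (w : List L) :
    wordVec M (a :: w) = M a *ᵥ wordVec M w := by
  simp [wordVec]

/-- A shortest word `w` with `δ·M(w)·1 ≠ 0` has length less than `|S|`: the pairings of its
prefixes with its suffixes form an invertible triangular matrix that factors through `ℝ^S`. -/
theorem length_lt_card_of_minimal (M : L → Matrix S S ℝ) (δ : S → ℝ) (w : List L)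
    (hw : δ ⬝ᵥ wordVec M w ≠ 0)
    (hmin : ∀ u : List L, u.length < w.length → δ ⬝ᵥ wordVec M u = 0) :
    w.length < Fintype.card S := by
  set n := w.length with hn
  let F : Matrix (Fin (n + 1)) S ℝ := Matrix.of fun i => δ ᵥ* ((w.take i).map M).prod
  let Y : Matrix S (Fin (n + 1)) ℝ := Matrix.of fun s j => wordVec M (w.drop j) s
  have hentry : ∀ i j, (F * Y) i j = δ ⬝ᵥ wordVec M (w.take i ++ w.drop j) := by
    intro i j
    rw [wordVec_append, Matrix.dotProduct_mulVec]
    rfl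
  have htri : (F * Y).IsLowerTriangular := by
    intro i j hij
    rw [hentry]
    apply hmin
    have hij' : (i : ℕ) < j := hij
    have := j.isLt
    simp only [List.length_append, List.length_take, List.length_drop]
    omega
  have hdet : (F * Y).det ≠ 0 := by
    rw [Matrix.det_of_isLowerTriangular _ htri, Finset.prod_ne_zero_iff]
    intro i _
    rw [hentry, List.take_append_drop]
    exact hw
  have hrank : (F * Y).rank = n + 1 := by
    rw [Matrix.rank_of_isUnit _ ((Matrix.isUnit_iff_isUnit_det _).2 hdet.isUnit), Fintype.card_fin]
  have h₁ := Matrix.rank_mul_le_left F Y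
  have h₂ := F.rank_le_card_width
  omega

theorem exists_short_word (M : L → Matrix S S ℝ) (δ : S → ℝ)
    (h : ∃ w, δ ⬝ᵥ wordVec M w ≠ 0) :
    ∃ w : List L, w.length ≤ Fintype.card S - 1 ∧ δ ⬝ᵥ wordVec M w ≠ 0 := by
  obtain ⟨w, hw, hmin⟩ := WellFounded.has_min (measure List.length).wf
    {w | δ ⬝ᵥ wordVec M w ≠ 0} h
  have := length_lt_card_of_minimal M δ w hw fun u hu =>
    not_not.1 fun hne => hmin u hne hu
  exact ⟨w, by omega, hw⟩

end ShortWord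

section Derandomise

variable {S A L : Type} [Fintype A]

theorem Mmat_mulVec [Fintype S] [DecidableEq L] (D : MDP S A L) (α : S → A → ℝ)
    (a : L) (v : S → ℝ) (r : S) :
    (D.Mmat α a *ᵥ v) r = if D.label r = a then D.tau α r ⬝ᵥ v else 0 := by
  by_cases h : D.label r = a <;> simp [Mmat, Matrix.mulVec, dotProduct, h]

variable [DecidableEq S] [DecidableEq A]

/-- The strategy that plays `m` in state `s` and agrees with `α` elsewhere. -/
def fixAt (α : S → A → ℝ) (s : S) (m : A) : S → A → ℝ :=
  Function.update α s (Pi.single m 1)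

theorem tau_fixAt_of_ne (D : MDP S A L) (α : S → A → ℝ) {s r : S} (m : A) (hr : r ≠ s) :
    D.tau (fixAt α s m) r = D.tau α r := by
  ext t
  simp [tau, fixAt, hr]

theorem tau_fixAt_self (D : MDP S A L) (α : S → A → ℝ) (s : S) (m : A) :
    D.tau (fixAt α s m) s = D.trans s m := by
  ext t
  simp [tau, fixAt, Pi.single_apply]

theorem IsStrategy.fixAt {D : MDP S A L} {α : S → A → ℝ} (hα : D.IsStrategy α) {s : S} {m : A}
    (hm : α s m ≠ 0) : D.IsStrategy (fixAt α s m) := by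
  intro r
  by_cases hr : r = s
  · subst hr
    simp only [MDP.fixAt, Function.update_self]
    refine ⟨fun m' => ?_, by simp, fun m' hm' => ?_⟩
    · by_cases h : m' = m <;> simp [h]
    · have hne : m' ≠ m := by
        rintro rfl
        exact hm ((hα r).2.2 _ hm')
      simp [hne]
  · simpa [MDP.fixAt, hr] using hα r

variable [Fintype S] [DecidableEq L]

theorem Mmat_fixAt_mulVec_of_ne (D : MDP S A L) (α : S → A → ℝ) {s r : S} (m : A) (hr : r ≠ s)
    (a : L) (v : S → ℝ) :
    (D.Mmat (fixAt α s m) a *ᵥ v) r = (D.Mmat α a *ᵥ v) r := by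
  rw [Mmat_mulVec, Mmat_mulVec, tau_fixAt_of_ne D α m hr]

theorem Mmat_mulVec_self (D : MDP S A L) (α : S → A → ℝ) (s : S) (a : L) (v : S → ℝ) :
    (D.Mmat α a *ᵥ v) s = ∑ m, α s m * (D.Mmat (fixAt α s m) a *ᵥ v) s := by
  simp only [Mmat_mulVec, tau_fixAt_self]
  by_cases h : D.label s = a
  · simp only [h, if_true, dotProduct, tau, Finset.sum_mul, Finset.mul_sum, mul_assoc]
    exact Finset.sum_comm
  · simp [h]

theorem vecMul_Mmat_fixAt (D : MDP S A L) (α : S → A → ℝ) {s : S} (m : A) (a : L) {δ : S → ℝ}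
    (hδ : δ s = 0) : δ ᵥ* D.Mmat (fixAt α s m) a = δ ᵥ* D.Mmat α a := by
  refine funext fun t => Finset.sum_congr rfl fun r _ => ?_
  by_cases hr : r = s
  · simp [hr, hδ]
  · simp [Mmat, tau_fixAt_of_ne D α m hr]

/-- If two choices of action at `s` yield different word vectors, then any `δ` annihilating the
word vectors for both choices vanishes at `s`. -/
theorem apply_eq_zero_of_wordVec_ne (D : MDP S A L) (α : S → A → ℝ) (s : S) (m m' : A) {w : List L}
    (hw : wordVec (D.Mmat (fixAt α s m)) w ≠ wordVec (D.Mmat (fixAt α s m')) w) {δ : S → ℝ}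
    (h : ∀ w, δ ⬝ᵥ wordVec (D.Mmat (fixAt α s m)) w = 0)
    (h' : ∀ w, δ ⬝ᵥ wordVec (D.Mmat (fixAt α s m')) w = 0) : δ s = 0 := by
  induction w with
  | nil => simp at hw
  | cons a w ih =>
    by_cases hsuf : wordVec (D.Mmat (fixAt α s m)) w = wordVec (D.Mmat (fixAt α s m')) w
    · set x := wordVec (D.Mmat (fixAt α s m)) (a :: w) with hx
      set y := wordVec (D.Mmat (fixAt α s m')) (a :: w) with hy
      have hne : ∀ r, r ≠ s → x r = y r := by
        intro r hr
        rw [hx, hy, wordVec_cons, wordVec_cons, ← hsuf, Mmat_fixAt_mulVec_of_ne D α m hr,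
          Mmat_fixAt_mulVec_of_ne D α m' hr]
      have hs : x s - y s ≠ 0 := by
        intro hs
        refine hw (funext fun r => ?_)
        by_cases hr : r = s
        · rw [hr]; exact sub_eq_zero.1 hs
        · exact hne r hr
      have hdot : δ ⬝ᵥ (x - y) = δ s * (x s - y s) := by
        refine Finset.sum_eq_single s (fun r _ hr => ?_) (by simp)
        simp [hne r hr]
      rw [dotProduct_sub, h, h', sub_zero] at hdot
      exact (mul_eq_zero.1 hdot.symm).resolve_right hs
    · exact ih hsuf

/-- If two choices of action at `s` yield different word vectors, then any `δ` annihilating the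
word vectors for both choices also annihilates those of `α`. -/
theorem dotProduct_wordVec_eq_zero_of_ne (D : MDP S A L) (α : S → A → ℝ) (s : S) (m m' : A)
    {w : List L} (hw : wordVec (D.Mmat (fixAt α s m)) w ≠ wordVec (D.Mmat (fixAt α s m')) w)
    (u : List L) (δ : S → ℝ)
    (h : ∀ w, δ ⬝ᵥ wordVec (D.Mmat (fixAt α s m)) w = 0)
    (h' : ∀ w, δ ⬝ᵥ wordVec (D.Mmat (fixAt α s m')) w = 0) :
    δ ⬝ᵥ wordVec (D.Mmat α) u = 0 := by
  induction u generalizing δ with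
  | nil => simpa using h []
  | cons a u ih =>
    have hδ := apply_eq_zero_of_wordVec_ne D α s m m' hw h h'
    rw [wordVec_cons, Matrix.dotProduct_mulVec]
    refine ih _ (fun v => ?_) fun v => ?_
    · rw [← vecMul_Mmat_fixAt D α m a hδ, ← Matrix.dotProduct_mulVec, ← wordVec_cons, h]
    · rw [← vecMul_Mmat_fixAt D α m' a hδ, ← Matrix.dotProduct_mulVec, ← wordVec_cons, h']

/-- If all actions in the support of `α s` yield the same word vectors, then so does `α`. -/
theorem wordVec_eq_fixAt (D : MDP S A L) (α : S → A → ℝ) (s : S) (hsum : ∑ m, α s m = 1)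
    (heq : ∀ m m', α s m ≠ 0 → α s m' ≠ 0 → ∀ w,
      wordVec (D.Mmat (fixAt α s m)) w = wordVec (D.Mmat (fixAt α s m')) w)
    {m : A} (hm : α s m ≠ 0) (w : List L) :
    wordVec (D.Mmat α) w = wordVec (D.Mmat (fixAt α s m)) w := by
  induction w with
  | nil => simp
  | cons a w ih =>
    rw [wordVec_cons, ih]
    ext r
    by_cases hr : r = s
    · subst hr
      have hterm : ∀ m', α r m' * (D.Mmat (fixAt α r m') a *ᵥ wordVec (D.Mmat (fixAt α r m)) w) r =
          α r m' * wordVec (D.Mmat (fixAt α r m)) (a :: w) r := by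
        intro m'
        by_cases hm' : α r m' = 0
        · simp [hm']
        · rw [heq m m' hm hm' w, ← wordVec_cons, heq m m' hm hm' (a :: w)]
      rw [Mmat_mulVec_self, Finset.sum_congr rfl fun m' _ => hterm m', ← Finset.sum_mul, hsum,
        one_mul]
    · rw [wordVec_cons, Mmat_fixAt_mulVec_of_ne D α m hr]

/-- A distinguishing strategy can be made deterministic at a given state. -/
theorem exists_fixAt_dotProduct_wordVec_ne_zero (D : MDP S A L) (α : S → A → ℝ) (s : S)
    (hsum : ∑ m, α s m = 1) (δ : S → ℝ) (h : ∃ w, δ ⬝ᵥ wordVec (D.Mmat α) w ≠ 0) :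
    ∃ m, α s m ≠ 0 ∧ ∃ w, δ ⬝ᵥ wordVec (D.Mmat (fixAt α s m)) w ≠ 0 := by
  by_contra! hcon
  obtain ⟨u, hu⟩ := h
  apply hu
  by_cases heq : ∀ m m', α s m ≠ 0 → α s m' ≠ 0 → ∀ w,
      wordVec (D.Mmat (fixAt α s m)) w = wordVec (D.Mmat (fixAt α s m')) w
  · obtain ⟨m, -, hm⟩ := Finset.exists_ne_zero_of_sum_ne_zero (hsum.trans_ne one_ne_zero)
    rw [wordVec_eq_fixAt D α s hsum heq hm, hcon m hm]
  · push Not at heq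
    obtain ⟨m, m', hm, hm', w, hw⟩ := heq
    exact dotProduct_wordVec_eq_zero_of_ne D α s m m' hw u δ (hcon m hm) (hcon m' hm')

theorem exists_deterministic_on (D : MDP S A L) (δ : S → ℝ)
    (h : ∃ α, D.IsStrategy α ∧ ∃ w, δ ⬝ᵥ wordVec (D.Mmat α) w ≠ 0) (T : Finset S) :
    ∃ α, D.IsStrategy α ∧ (∀ s ∈ T, ∃ m, α s = Pi.single m 1) ∧
      ∃ w, δ ⬝ᵥ wordVec (D.Mmat α) w ≠ 0 := by
  induction T using Finset.induction_on with
  | empty => simpa using h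
  | insert s T _ ih =>
    obtain ⟨α, hα, hdet, hw⟩ := ih
    obtain ⟨m, hm, hw'⟩ := exists_fixAt_dotProduct_wordVec_ne_zero D α s (hα s).2.1 δ hw
    refine ⟨fixAt α s m, hα.fixAt hm, fun r hr => ?_, hw'⟩
    by_cases hrs : r = s
    · exact ⟨m, by simp [fixAt, hrs]⟩
    · simpa [fixAt, hrs] using hdet r (Finset.mem_of_mem_insert_of_ne hr hrs)

theorem exists_md_dotProduct_wordVec_ne_zero (D : MDP S A L) (δ : S → ℝ)
    (h : ∃ α, D.IsStrategy α ∧ ∃ w, δ ⬝ᵥ wordVec (D.Mmat α) w ≠ 0) :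
    ∃ β : S → A, D.IsMD β ∧ ∃ w, δ ⬝ᵥ wordVec (D.Mmat (mdStrat β)) w ≠ 0 := by
  obtain ⟨α, hα, hdet, hw⟩ := exists_deterministic_on D δ h Finset.univ
  choose β hβ using fun s => hdet s (Finset.mem_univ s)
  have hαβ : α = mdStrat β := by
    ext s m
    simp [hβ, mdStrat, Pi.single_apply]
  refine ⟨β, fun s => ?_, hαβ ▸ hw⟩
  rw [Option.isSome_iff_ne_none]
  intro hnone
  simpa [hβ] using (hα s).2.2 (β s) hnone

end Derandomise

end MDP

namespace MDP

variable {S A L : Type} [Fintype S] [Fintype A] [Fintype L]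
  [DecidableEq S] [DecidableEq A] [DecidableEq L]

/-- if some memoryless strategy and word witness
`μ·M_α(w)·1 ≠ ν·M_α(w)·1`, then some MD strategy and word of length at most
`|S| - 1` do as well. -/
theorem exists_md_short_witness
    (D : MDP S A L) (hD : D.IsValid) (μ ν : S → ℝ)
    (hμ : (∀ s, 0 ≤ μ s) ∧ (∑ s, μ s) = 1)
    (hν : (∀ s, 0 ≤ ν s) ∧ (∑ s, ν s) = 1)
    (h : ∃ α, D.IsStrategy α ∧ ∃ w : List L,
      μ ⬝ᵥ (D.Mword α w).mulVec 1 ≠ ν ⬝ᵥ (D.Mword α w).mulVec 1) :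
    ∃ β : S → A, D.IsMD β ∧ ∃ w' : List L, w'.length ≤ Fintype.card S - 1 ∧
      μ ⬝ᵥ (D.Mword (mdStrat β) w').mulVec 1 ≠ ν ⬝ᵥ (D.Mword (mdStrat β) w').mulVec 1 := by
  have hsub : ∀ (α : S → A → ℝ) (w : List L),
      (μ - ν) ⬝ᵥ wordVec (D.Mmat α) w ≠ 0 ↔
        μ ⬝ᵥ (D.Mword α w).mulVec 1 ≠ ν ⬝ᵥ (D.Mword α w).mulVec 1 := fun α w => by
    rw [sub_dotProduct, sub_ne_zero]
    rfl
  simp only [← hsub] at h ⊢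
  obtain ⟨β, hβ, hw⟩ := exists_md_dotProduct_wordVec_ne_zero D (μ - ν) h
  exact ⟨β, hβ, exists_short_word _ _ hw⟩

end MDP
end

section
/- For all i ∈ ℕ, the equivalence relation ≡_{X_{i+1}} is contained in the equivalence relation ≡_{X_i}, where X₀ = {S} and X_{i+1} = S/≡_{X_i} is the partition-refinement sequence. -/
open Matrix

namespace MDP

variable {S A L : Type} [Fintype S] [Fintype A] [DecidableEq S]

open Classical in
/-- `φ(s,m)(E)`: the transition probability from `s` to the set `E ⊆ S` under
action `m`. -/
noncomputable def phiE (D : MDP S A L) (s : S) (m : A) (E : Set S) : ℝ :=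
  ∑ t, if t ∈ E then D.trans s m t else 0

/-- `φ(s,m)(X)`: the vector `(φ(s,m)(E))_{E ∈ X}` over a partition `X`. -/
noncomputable def phiVec (D : MDP S A L) (X : Set (Set S)) (s : S) (m : A) : X → ℝ :=
  fun E => D.phiE s m E.1

/-- `φ(s)(X) = {φ(s,m)(X) : m ∈ A(s)}`. -/
def phiSet (D : MDP S A L) (X : Set (Set S)) (s : S) : Set (X → ℝ) :=
  {v | ∃ m, (D.phi s m).isSome ∧ v = D.phiVec X s m}

/-- The equivalence relation `≡_X` associated with a partition `X`:
`s ≡_X s'` iff `ℓ(s) = ℓ(s')`, and if `s ≠ s'` then `|φ(s)(X)| = 1` and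
`φ(s)(X) = φ(s')(X)`. -/
def equivX (D : MDP S A L) (X : Set (Set S)) (s s' : S) : Prop :=
  D.label s = D.label s' ∧
    (s ≠ s' → (∃ v, D.phiSet X s = {v}) ∧ D.phiSet X s = D.phiSet X s')

/-- The partition-refinement sequence: `X₀ = {S}` and `X_{i+1} = S/≡_{X_i}`. -/
def partseq (D : MDP S A L) : ℕ → Set (Set S)
  | 0 => {Set.univ}
  | i + 1 => {E | ∃ s, E = {t | D.equivX (D.partseq i) s t}}

end MDP

namespace MDP

variable {S A L : Type} [Fintype S]

/-- The equivalence relation `≡_X`, bundled as a setoid. -/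
def equivXSetoid (D : MDP S A L) (X : Set (Set S)) : Setoid S where
  r := D.equivX X
  iseqv :=
    { refl := fun _ => ⟨rfl, fun h => absurd rfl h⟩
      symm := fun {s t} h => ⟨h.1.symm, fun hne => by
        obtain ⟨⟨v, hv⟩, hst⟩ := h.2 hne.symm
        exact ⟨⟨v, hst ▸ hv⟩, hst.symm⟩⟩
      trans := fun {s t u} h h' => ⟨h.1.trans h'.1, fun hne => by
        by_cases hst : s = t
        · subst hst
          exact h'.2 hne
        by_cases htu : t = u
        · subst htu
          exact h.2 hne
        exact ⟨(h.2 hst).1, (h.2 hst).2.trans (h'.2 htu).2⟩⟩ }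

/-- The probability of a set saturated under a setoid is the sum of the probabilities of the
equivalence classes it contains. -/
theorem phiE_eq_sum_quotient (D : MDP S A L) (r : Setoid S) [Fintype (Quotient r)] {E : Set S}
    [DecidablePred (· ∈ E)] (hE : ∀ s t, r s t → s ∈ E → t ∈ E) (s : S) (m : A) :
    D.phiE s m E = ∑ q : Quotient r, if q.out ∈ E then D.phiE s m {t | r q.out t} else 0 := by
  classical
  unfold phiE
  rw [← Finset.sum_fiberwise Finset.univ (fun t => (Quotient.mk r t))]
  refine Finset.sum_congr rfl fun q _ => ?_
  have hq : ∀ t, Quotient.mk r t = q ↔ r q.out t := fun t => by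
    rw [← Quotient.eq (r := r), Quotient.out_eq, eq_comm]
  rw [Finset.sum_filter]
  split_ifs with hqE
  · refine Finset.sum_congr rfl fun t _ => ?_
    by_cases ht : r q.out t
    · simp [hq, ht, hE _ _ ht hqE]
    · simp [hq, ht]
  · refine Finset.sum_eq_zero fun t _ => ?_
    by_cases ht : r q.out t
    · have htE : t ∉ E := fun h => hqE (hE _ _ (r.symm ht) h)
      simp [htE]
    · simp [hq, ht]

/-- Vectors over the classes of a setoid determine vectors over any coarser family of sets. -/
theorem phiVec_eq_of_saturated (D : MDP S A L) (r : Setoid S) {X : Set (Set S)}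
    (hX : ∀ E ∈ X, ∀ s t, r s t → s ∈ E → t ∈ E) {s s' : S} {m m' : A}
    (h : D.phiVec {E | ∃ x, E = {t | r x t}} s m = D.phiVec {E | ∃ x, E = {t | r x t}} s' m') :
    D.phiVec X s m = D.phiVec X s' m' := by
  classical
  funext ⟨E, hE⟩
  have hclass (x : S) : D.phiE s m {t | r x t} = D.phiE s' m' {t | r x t} :=
    congrFun h ⟨_, x, rfl⟩
  simp only [phiVec, D.phiE_eq_sum_quotient r (hX E hE), hclass]

/-- If every set in `X` is saturated under `≡_X`, then refining `X` to the classes of `≡_X`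
refines the induced equivalence relation. -/
theorem equivX_of_equivX_classes (D : MDP S A L) (hD : D.IsValid) {X : Set (Set S)}
    (hX : ∀ E ∈ X, ∀ s t, D.equivX X s t → s ∈ E → t ∈ E) {s t : S}
    (h : D.equivX {E | ∃ x, E = {y | D.equivX X x y}} s t) : D.equivX X s t := by
  refine ⟨h.1, fun hne => ?_⟩
  obtain ⟨⟨v, hs⟩, hst⟩ := h.2 hne
  have ht := hst ▸ hs
  obtain ⟨m, hm⟩ := hD.1 s
  have hmv := hs.subset ⟨m, hm, rfl⟩
  have key : ∀ u, D.phiSet {E | ∃ x, E = {y | D.equivX X x y}} u = {v} →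
      D.phiSet X u = {D.phiVec X s m} := by
    intro u hu
    have hconst : ∀ n, (D.phi u n).isSome → D.phiVec X u n = D.phiVec X s m := fun n hn =>
      D.phiVec_eq_of_saturated (D.equivXSetoid X) hX
        ((hu.subset ⟨n, hn, rfl⟩ : _ = v).trans (Eq.symm hmv))
    refine Set.Subset.antisymm ?_ ?_
    · rintro _ ⟨n, hn, rfl⟩
      exact hconst n hn
    · rintro _ rfl
      obtain ⟨n, hn⟩ := hD.1 u
      exact ⟨n, hn, (hconst n hn).symm⟩
  exact ⟨⟨_, key s hs⟩, (key s hs).trans (key t ht).symm⟩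

/-- Every block of the partition-refinement sequence is saturated under the next relation. -/
theorem partseq_saturated (D : MDP S A L) (hD : D.IsValid) (i : ℕ) :
    ∀ E ∈ D.partseq i, ∀ s t, D.equivX (D.partseq i) s t → s ∈ E → t ∈ E := by
  induction i with
  | zero =>
    rintro _ rfl s t - -
    trivial
  | succ i ih =>
    rintro _ ⟨x, rfl⟩ s t hst hs
    exact (D.equivXSetoid (D.partseq i)).trans hs (D.equivX_of_equivX_classes hD ih hst)

end MDP

namespace MDP

variable {S A L : Type} [Fintype S] [Fintype A] [DecidableEq S]

/-- the equivalence relation `≡_{X_{i+1}}` is contained in `≡_{X_i}`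
along the partition-refinement sequence. -/
theorem equivX_partseq_succ_subset
    (D : MDP S A L) (hD : D.IsValid) (i : ℕ) :
    ∀ s t : S, D.equivX (D.partseq (i + 1)) s t → D.equivX (D.partseq i) s t :=
  fun _ _ h => D.equivX_of_equivX_classes hD (D.partseq_saturated hD i) h

end MDP
end

section
/- Let X be a partition of S satisfying X = S/≡_X. Then for every memoryless strategy α, the relation ≡_X is a probabilistic bisimulation in the induced labelled Markov chain D(α); in particular ≡_X ⊆ ∼_{D(α)} for all memoryless strategies α. -/
open Matrix

namespace MDP

variable {S A L : Type} [Fintype S] [Fintype A] [DecidableEq S]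

open Classical in
/-- `τ(s)(E)`: the transition probability from `s` to the set `E ⊆ S` in the
labelled Markov chain `D(α)`. -/
noncomputable def tauE (D : MDP S A L) (α : S → A → ℝ) (s : S) (E : Set S) : ℝ :=
  ∑ t, if t ∈ E then D.tau α s t else 0

/-- `R` is a probabilistic bisimulation in the labelled Markov chain `D(α)`:
an equivalence relation relating only equally labelled states with equal
transition probabilities into every `R`-equivalence class. -/
def IsProbBisim (D : MDP S A L) (α : S → A → ℝ) (R : S → S → Prop) : Prop :=
  Equivalence R ∧ ∀ s t, R s t →
    D.label s = D.label t ∧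
      ∀ E : Set S, (∃ u, E = {v | R u v}) → D.tauE α s E = D.tauE α t E

/-- Probabilistic bisimilarity `∼_{D(α)}`: the largest probabilistic bisimulation,
i.e. `s ∼ t` iff some probabilistic bisimulation relates `s` and `t`. -/
def Bisimilar (D : MDP S A L) (α : S → A → ℝ) (s t : S) : Prop :=
  ∃ R, D.IsProbBisim α R ∧ R s t

end MDP

namespace MDP

variable {S A L : Type} [Fintype S]

/-- The relation `≡_X` is an equivalence relation for every family `X` of sets of states. -/
theorem equivX_equivalence (D : MDP S A L) (X : Set (Set S)) : Equivalence (D.equivX X) where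
  refl _ := ⟨rfl, fun h => (h rfl).elim⟩
  symm := by
    rintro s t ⟨hl, h⟩
    refine ⟨hl.symm, fun hne => ?_⟩
    obtain ⟨hv, heq⟩ := h hne.symm
    exact ⟨heq ▸ hv, heq.symm⟩
  trans := by
    rintro s t u ⟨hl, h⟩ ⟨hl', h'⟩
    refine ⟨hl.trans hl', fun hne => ?_⟩
    rcases eq_or_ne s t with rfl | hst
    · exact h' hne
    rcases eq_or_ne t u with rfl | htu
    · exact h hne
    exact ⟨(h hst).1, (h hst).2.trans (h' htu).2⟩

variable [Fintype A]

/-- The transition probability into a set in `D(α)` is the `α`-average of the transition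
probabilities of the actions. -/
theorem tauE_eq_sum_phiE (D : MDP S A L) (α : S → A → ℝ) (s : S) (E : Set S) :
    D.tauE α s E = ∑ m, α s m * D.phiE s m E := by
  classical
  simp only [tauE, phiE, tau, Finset.mul_sum, mul_ite, mul_zero]
  rw [Finset.sum_comm]
  refine Finset.sum_congr rfl fun t _ => ?_
  split_ifs <;> simp

/-- If all available actions of `s` have the same vector `v` of transition probabilities over `X`,
then `v` also gives the transition probabilities over `X` in `D(α)`. -/
theorem tauE_eq_of_phiSet_eq_singleton {D : MDP S A L} {α : S → A → ℝ} (hα : D.IsStrategy α)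
    {X : Set (Set S)} {s : S} {v : X → ℝ} (hv : D.phiSet X s = {v}) (E : X) :
    D.tauE α s E = v E := by
  obtain ⟨-, hsum, hnone⟩ := hα s
  have hterm (m : A) : α s m * D.phiE s m E = α s m * v E := by
    by_cases hm : (D.phi s m).isSome
    · have hmem : D.phiVec X s m ∈ D.phiSet X s := ⟨m, hm, rfl⟩
      rw [hv, Set.mem_singleton_iff] at hmem
      rw [← hmem, phiVec]
    · rw [hnone m (Option.not_isSome_iff_eq_none.mp hm), zero_mul, zero_mul]
  simp_rw [tauE_eq_sum_phiE, hterm]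
  rw [← Finset.sum_mul, hsum, one_mul]

end MDP

namespace MDP

variable {S A L : Type} [Fintype S] [Fintype A] [DecidableEq S]

/-- if `X` is a partition of `S` with `X = S/≡_X`, then for every
memoryless strategy `α` the relation `≡_X` is a probabilistic bisimulation in
`D(α)`; in particular `≡_X ⊆ ∼_{D(α)}`. -/
theorem equivX_isProbBisim
    (D : MDP S A L) (hD : D.IsValid) (X : Set (Set S))
    (hpart : Setoid.IsPartition X)
    (hX : X = {E | ∃ s, E = {t | D.equivX X s t}}) :
    ∀ α, D.IsStrategy α →
      D.IsProbBisim α (D.equivX X) ∧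
        ∀ s t, D.equivX X s t → D.Bisimilar α s t := by
  intro α hα
  have hbisim : D.IsProbBisim α (D.equivX X) := by
    refine ⟨D.equivX_equivalence X, fun s t hst => ⟨hst.1, fun E hE => ?_⟩⟩
    rcases eq_or_ne s t with rfl | hne
    · rfl
    obtain ⟨⟨v, hv⟩, heq⟩ := hst.2 hne
    have hEX : E ∈ X := hX ▸ hE
    rw [tauE_eq_of_phiSet_eq_singleton hα hv ⟨E, hEX⟩,
      tauE_eq_of_phiSet_eq_singleton hα (heq ▸ hv) ⟨E, hEX⟩]
  exact ⟨hbisim, fun s t hst => ⟨D.equivX X, hbisim, hst⟩⟩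

end MDP
end

section
/- For every labelled Markov decision process D there exists a memoryless strategy β such that ∼_{D(β)} ⊆ ∼_{D(α)} for all memoryless strategies α, i.e., whenever two states are probabilistic bisimilar in D(β) they are probabilistic bisimilar in D(α) for every memoryless strategy α. -/
open Matrix

namespace MDP

variable {S A L : Type} [Fintype A]

/-- The convex combination `(1 - c) • β + c • α` of two strategies. -/
def mix (β α : S → A → ℝ) (c : ℝ) : S → A → ℝ :=
  fun s m => (1 - c) * β s m + c * α s m

theorem IsStrategy.mix {D : MDP S A L} {β α : S → A → ℝ} (hβ : D.IsStrategy β)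
    (hα : D.IsStrategy α) {c : ℝ} (hc₀ : 0 ≤ c) (hc₁ : c ≤ 1) :
    D.IsStrategy (mix β α c) := by
  intro s
  obtain ⟨hβ₀, hβ₁, hβn⟩ := hβ s
  obtain ⟨hα₀, hα₁, hαn⟩ := hα s
  refine ⟨fun m => ?_, ?_, fun m hm => ?_⟩
  · exact add_nonneg (mul_nonneg (sub_nonneg.2 hc₁) (hβ₀ m)) (mul_nonneg hc₀ (hα₀ m))
  · simp only [MDP.mix, Finset.sum_add_distrib, ← Finset.mul_sum, hβ₁, hα₁]
    ring
  · simp [MDP.mix, hβn m hm, hαn m hm]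

theorem tau_mix (D : MDP S A L) (β α : S → A → ℝ) (c : ℝ) (s t : S) :
    D.tau (mix β α c) s t = (1 - c) * D.tau β s t + c * D.tau α s t := by
  simp only [tau, mix, Finset.mul_sum, ← Finset.sum_add_distrib]
  exact Finset.sum_congr rfl fun m _ => by ring

variable [Fintype S]

theorem IsValid.exists_isStrategy {D : MDP S A L} (hD : D.IsValid) :
    ∃ β, D.IsStrategy β := by
  classical
  choose f hf using hD.1
  refine ⟨mdStrat f, fun s => ⟨fun m => ?_, ?_, fun m hm => ?_⟩⟩
  · unfold mdStrat
    split_ifs <;> norm_num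
  · simp [mdStrat]
  · have hne : m ≠ f s := by
      rintro rfl
      simpa [hm] using hf s
    simp [mdStrat, hne]

theorem tauE_mix (D : MDP S A L) (β α : S → A → ℝ) (c : ℝ) (s : S) (E : Set S) :
    D.tauE (mix β α c) s E = (1 - c) * D.tauE β s E + c * D.tauE α s E := by
  simp only [tauE, tau_mix, Finset.mul_sum, ← Finset.sum_add_distrib]
  exact Finset.sum_congr rfl fun t _ => by split_ifs <;> simp

/-- The bisimulation conditions are affine along a segment of strategies, so a relation that is
a bisimulation at two distinct points is one at both endpoints. -/
theorem IsProbBisim.endpoints_of_mix {D : MDP S A L} {β α : S → A → ℝ} {R : S → S → Prop}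
    {c d : ℝ} (hcd : c ≠ d) (hc : D.IsProbBisim (mix β α c) R)
    (hd : D.IsProbBisim (mix β α d) R) :
    D.IsProbBisim β R ∧ D.IsProbBisim α R := by
  have key : ∀ s t, R s t → ∀ E : Set S, (∃ u, E = {v | R u v}) →
      D.tauE β s E = D.tauE β t E ∧ D.tauE α s E = D.tauE α t E := by
    intro s t hst E hE
    have h₁ := (hc.2 s t hst).2 E hE
    have h₂ := (hd.2 s t hst).2 E hE
    simp only [tauE_mix] at h₁ h₂
    have h₃ := mul_left_cancel₀ (sub_ne_zero.2 hcd)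
      (show (c - d) * (D.tauE α s E - D.tauE β s E) =
        (c - d) * (D.tauE α t E - D.tauE β t E) by linear_combination h₁ - h₂)
    have h₄ : D.tauE β s E = D.tauE β t E := by linear_combination h₁ - c * h₃
    exact ⟨h₄, by linear_combination h₃ + h₄⟩
  exact ⟨⟨hc.1, fun s t h => ⟨(hc.2 s t h).1, fun E hE => (key s t h E hE).1⟩⟩,
    ⟨hc.1, fun s t h => ⟨(hc.2 s t h).1, fun E hE => (key s t h E hE).2⟩⟩⟩

/-- Some mixture of two strategies has only common bisimulations of both. -/
theorem exists_isStrategy_isProbBisim_imp {D : MDP S A L} {β α : S → A → ℝ}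
    (hβ : D.IsStrategy β) (hα : D.IsStrategy α) :
    ∃ γ, D.IsStrategy γ ∧
      ∀ R, D.IsProbBisim γ R → D.IsProbBisim β R ∧ D.IsProbBisim α R := by
  let bad (R : S → S → Prop) : Set ℝ :=
    {c | D.IsProbBisim (mix β α c) R ∧ ¬(D.IsProbBisim β R ∧ D.IsProbBisim α R)}
  have hbad : (⋃ R, bad R).Finite := Set.finite_iUnion fun R =>
    Set.Subsingleton.finite fun c hc d hd => by
      by_contra hcd
      exact hc.2 (hc.1.endpoints_of_mix hcd hd.1)
  obtain ⟨c, hc, hcbad⟩ :=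
    (Set.Ioo_infinite (zero_lt_one : (0 : ℝ) < 1)).exists_notMem_finite hbad
  refine ⟨mix β α c, hβ.mix hα hc.1.le hc.2.le, fun R hR => ?_⟩
  by_contra h
  exact hcbad (Set.mem_iUnion.2 ⟨R, hR, h⟩)

end MDP

namespace MDP

variable {S A L : Type} [Fintype S] [Fintype A] [DecidableEq S]

/-- there is a memoryless strategy `β` such that
`∼_{D(β)} ⊆ ∼_{D(α)}` for all memoryless strategies `α`. -/
theorem exists_finest_bisimilarity_strategy
    (D : MDP S A L) (hD : D.IsValid) :
    ∃ β, D.IsStrategy β ∧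
      ∀ α, D.IsStrategy α → ∀ s t, D.Bisimilar β s t → D.Bisimilar α s t := by
  obtain ⟨β₀, hβ₀⟩ := hD.exists_isStrategy
  obtain ⟨_, ⟨β, hβ, rfl⟩, hmin⟩ :=
    (Set.toFinite ((fun β => {R | D.IsProbBisim β R}) '' {β | D.IsStrategy β})).exists_minimal
      ⟨_, β₀, hβ₀, rfl⟩
  refine ⟨β, hβ, fun α hα s t ⟨R, hR, hst⟩ => ?_⟩
  obtain ⟨γ, hγ, h⟩ := exists_isStrategy_isProbBisim_imp hβ hα
  have hRγ : D.IsProbBisim γ R := hmin ⟨γ, hγ, rfl⟩ (fun R' hR' => (h R' hR').1) hR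
  exact ⟨R, (h R hRγ).2, hst⟩

end MDP
end

section
/- For every labelled Markov decision process D there exists a memoryless strategy β such that for all states s, t ∈ S: there exists a memoryless strategy α with s not probabilistic bisimilar to t in D(α) if and only if s is not probabilistic bisimilar to t in D(β). -/
open Matrix

/-- A nonempty convex set is not covered by finitely many subspaces none of which contains it. -/
theorem Convex.exists_forall_notMem_submodule {ι V : Type*} [AddCommGroup V] [Module ℝ V]
    {K : Set V} (hK : Convex ℝ K) (hne : K.Nonempty) (p : ι → Submodule ℝ V) (F : Finset ι)
    (hp : ∀ i ∈ F, ∃ x ∈ K, x ∉ p i) : ∃ x ∈ K, ∀ i ∈ F, x ∉ p i := by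
  classical
  induction F using Finset.induction_on with
  | empty => exact hne.imp fun x hx => ⟨hx, by simp⟩
  | insert j F _ ih =>
    obtain ⟨x, hxK, hx⟩ := ih fun i hi => hp i (Finset.mem_insert_of_mem hi)
    obtain ⟨y, hyK, hy⟩ := hp j (Finset.mem_insert_self j F)
    have hsub : ∀ i ∈ insert j F, {r : ℝ | x + r • (y - x) ∈ p i}.Subsingleton := by
      intro i hi a ha b hb
      by_contra hab
      have hd : (a - b) • (y - x) ∈ p i := by
        have h := (p i).sub_mem ha hb
        rwa [add_sub_add_left_eq_sub, ← sub_smul] at h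
      have hyx : y - x ∈ p i := ((p i).smul_mem_iff (sub_ne_zero.mpr hab)).mp hd
      have hxp : x ∈ p i := ((p i).add_mem_iff_left ((p i).smul_mem a hyx)).mp ha
      have hyp : y ∈ p i := ((p i).sub_mem_iff_left hxp).mp hyx
      rcases Finset.mem_insert.mp hi with rfl | hi
      · exact hy hyp
      · exact hx i hi hxp
    have hfin : (⋃ i ∈ insert j F, {r : ℝ | x + r • (y - x) ∈ p i}).Finite :=
      (insert j F).finite_toSet.biUnion fun i hi => (hsub i hi).finite
    obtain ⟨r, hr, hr'⟩ := (Set.Icc_infinite (zero_lt_one' ℝ)).exists_notMem_finite hfin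
    refine ⟨x + r • (y - x), hK.add_smul_sub_mem hxK hyK hr, fun i hi hmem => hr' ?_⟩
    exact Set.mem_biUnion hi hmem

namespace MDP

variable {S A L : Type} [Fintype A]

theorem convex_setOf_isStrategy (D : MDP S A L) : Convex ℝ {α | D.IsStrategy α} := by
  intro α hα β hβ a b ha hb hab s
  obtain ⟨hα₀, hα₁, hα₂⟩ := hα s
  obtain ⟨hβ₀, hβ₁, hβ₂⟩ := hβ s
  refine ⟨fun m => ?_, ?_, fun m hm => ?_⟩
  · exact add_nonneg (mul_nonneg ha (hα₀ m)) (mul_nonneg hb (hβ₀ m))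
  · simp [Finset.sum_add_distrib, ← Finset.mul_sum, hα₁, hβ₁, hab]
  · simp [hα₂ m hm, hβ₂ m hm]

theorem exists_isStrategy (D : MDP S A L) (h : ∀ s, ∃ m, (D.phi s m).isSome) :
    ∃ α, D.IsStrategy α := by
  classical
  choose f hf using h
  refine ⟨fun s => Pi.single (f s) 1, fun s => ⟨fun m => ?_, by simp, fun m hm => ?_⟩⟩
  · exact (Pi.single_nonneg.mpr zero_le_one : (0 : A → ℝ) ≤ Pi.single (f s) 1) m
  · refine Pi.single_eq_of_ne ?_ _
    rintro rfl
    simpa [hm] using hf s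

variable [Fintype S]

theorem tauE_add (D : MDP S A L) (α β : S → A → ℝ) (s : S) (E : Set S) :
    D.tauE (α + β) s E = D.tauE α s E + D.tauE β s E := by
  classical
  simp only [tauE, tau, Pi.add_apply, add_mul, ← Finset.sum_add_distrib]
  refine Finset.sum_congr rfl fun t _ => ?_
  split_ifs <;> simp [Finset.sum_add_distrib]

theorem tauE_smul (D : MDP S A L) (c : ℝ) (α : S → A → ℝ) (s : S) (E : Set S) :
    D.tauE (c • α) s E = c * D.tauE α s E := by
  classical
  simp [tauE, tau, Finset.mul_sum, mul_assoc]

/-- The weights `α` under which `R`-related states have the same transition weight into every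
`R`-class. -/
def lumpingSubmodule (D : MDP S A L) (R : S → S → Prop) : Submodule ℝ (S → A → ℝ) where
  carrier := {α | ∀ s t, R s t → ∀ E : Set S, (∃ u, E = {v | R u v}) →
    D.tauE α s E = D.tauE α t E}
  add_mem' hα hβ s t hst E hE := by
    rw [tauE_add, tauE_add, hα s t hst E hE, hβ s t hst E hE]
  zero_mem' s t _ E _ := by simp [tauE, tau]
  smul_mem' c α hα s t hst E hE := by
    rw [tauE_smul, tauE_smul, hα s t hst E hE]

theorem isProbBisim_iff (D : MDP S A L) (α : S → A → ℝ) (R : S → S → Prop) :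
    D.IsProbBisim α R ↔
      (Equivalence R ∧ ∀ s t, R s t → D.label s = D.label t) ∧ α ∈ D.lumpingSubmodule R :=
  ⟨fun h => ⟨⟨h.1, fun s t hst => (h.2 s t hst).1⟩, fun s t hst => (h.2 s t hst).2⟩,
    fun h => ⟨h.1.1, fun s t hst => ⟨h.1.2 s t hst, h.2 s t hst⟩⟩⟩

end MDP

namespace MDP

variable {S A L : Type} [Fintype S] [Fintype A] [DecidableEq S]

/-- there is a memoryless strategy `β` such that for all states `s, t`:
some memoryless strategy makes `s` and `t` not probabilistic bisimilar iff `s` and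
`t` are not probabilistic bisimilar in `D(β)`. -/
theorem exists_universal_inequivalence_strategy
    (D : MDP S A L) (hD : D.IsValid) :
    ∃ β, D.IsStrategy β ∧
      ∀ s t : S,
        (∃ α, D.IsStrategy α ∧ ¬ D.Bisimilar α s t) ↔ ¬ D.Bisimilar β s t := by
  classical
  obtain ⟨β, hβ, hβ'⟩ := D.convex_setOf_isStrategy.exists_forall_notMem_submodule
    (D.exists_isStrategy hD.1) D.lumpingSubmodule
    {R | ∃ α ∈ {α | D.IsStrategy α}, α ∉ D.lumpingSubmodule R}
    fun R hR => (Finset.mem_filter.mp hR).2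
  refine ⟨β, hβ, fun s t => ⟨?_, fun h => ⟨β, hβ, h⟩⟩⟩
  rintro ⟨α, hα, hst⟩ ⟨R, hR, hRst⟩
  rw [isProbBisim_iff] at hR
  refine hst ⟨R, (D.isProbBisim_iff α R).mpr ⟨hR.1, ?_⟩, hRst⟩
  by_contra hαR
  exact hβ' R (Finset.mem_filter.mpr ⟨Finset.mem_univ R, α, hα, hαR⟩) hR.2

end MDP
end

section
/- Let α₀ be an MD strategy, let α' be any memoryless strategy, and let a ∈ L. Then M_{α'}(a) = M_{α₀}(a) + Σ_{s ∈ S} ( −M_{α₀}(a) + Σ_{m ∈ A(s)} α'(s)(m) · M_{α₀^{s→m}}(a) ); in particular, M_{α'}(a) is a linear combination of the matrices M_{α₀}(a) and M_{α₀^{s→m}}(a) for s ∈ S, m ∈ A(s). -/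
open Matrix

namespace MDP

variable {S A L : Type} [Fintype S] [Fintype A] [Fintype L]
  [DecidableEq S] [DecidableEq A] [DecidableEq L]

/-- Entries of the matrix of an MD strategy. -/
theorem mmat_mdStrat_apply {S A L : Type} [Fintype A] [DecidableEq A] [DecidableEq L]
    (D : MDP S A L) (β : S → A) (a : L) (s t : S) :
    D.Mmat (mdStrat β) a s t = if D.label s = a then D.trans s (β s) t else 0 := by
  simp [Mmat, tau, mdStrat]

/-- A memoryless strategy only weighs available actions, so its total weight on them is `1`. -/
theorem IsStrategy.sum_filter_eq_one {S A L : Type} [Fintype A]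
    {D : MDP S A L} {α : S → A → ℝ} (hα : D.IsStrategy α) (s : S) :
    ∑ m ∈ Finset.univ.filter (fun m => (D.phi s m).isSome), α s m = 1 := by
  rw [← (hα s).2.1]
  refine Finset.sum_subset (Finset.filter_subset _ _) fun m _ hm => (hα s).2.2 m ?_
  simpa using hm

/-- Changing an MD strategy at `s` only affects row `s`: averaging the updated matrices over
the actions at `s` and subtracting the original leaves the difference of the rows at `s`. -/
theorem neg_mmat_add_sum_update_apply {S A L : Type} [Fintype A]
    [DecidableEq S] [DecidableEq A] [DecidableEq L]
    {D : MDP S A L} {α : S → A → ℝ} (hα : D.IsStrategy α) (β : S → A) (a : L) (s u t : S) :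
    (-(D.Mmat (mdStrat β) a) +
        ∑ m ∈ Finset.univ.filter (fun m => (D.phi s m).isSome),
          α s m • D.Mmat (mdStrat (Function.update β s m)) a) u t =
      if u = s then D.Mmat α a u t - D.Mmat (mdStrat β) a u t else 0 := by
  simp only [Matrix.add_apply, Matrix.neg_apply, Matrix.sum_apply, Matrix.smul_apply,
    smul_eq_mul]
  split_ifs with h
  · subst h
    have key : ∑ m ∈ Finset.univ.filter (fun m => (D.phi u m).isSome),
        α u m * D.Mmat (mdStrat (Function.update β u m)) a u t = D.Mmat α a u t := by
      simp only [mmat_mdStrat_apply, Function.update_self]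
      by_cases hu : D.label u = a
      · simp only [Mmat, Matrix.of_apply, tau, if_pos hu]
        refine Finset.sum_subset (Finset.filter_subset _ _) fun m _ hm => ?_
        rw [(hα u).2.2 m (by simpa using hm), zero_mul]
      · simp [Mmat, hu]
    rw [key]
    ring
  · simp only [mmat_mdStrat_apply, Function.update_of_ne h]
    rw [← Finset.sum_mul, hα.sum_filter_eq_one s]
    ring

/-- for an MD strategy `β₀`, any memoryless strategy `α'` and label `a`,
`M_{α'}(a) = M_{β₀}(a) + Σ_{s∈S} (−M_{β₀}(a) + Σ_{m∈A(s)} α'(s)(m)·M_{β₀^{s→m}}(a))`;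
in particular `M_{α'}(a)` is a linear combination of the matrices `M_{β₀}(a)` and
`M_{β₀^{s→m}}(a)`. -/
theorem mmat_strategy_linear_combination
    (D : MDP S A L) (hD : D.IsValid)
    (β₀ : S → A) (h₀ : D.IsMD β₀) (α' : S → A → ℝ) (hα' : D.IsStrategy α') (a : L) :
    D.Mmat α' a =
      D.Mmat (mdStrat β₀) a +
        ∑ s : S,
          (-(D.Mmat (mdStrat β₀) a) +
            ∑ m ∈ Finset.univ.filter (fun m => (D.phi s m).isSome),
              α' s m • D.Mmat (mdStrat (Function.update β₀ s m)) a) ∧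
    D.Mmat α' a ∈
      Submodule.span ℝ
        ({D.Mmat (mdStrat β₀) a} ∪
          {M | ∃ s m, (D.phi s m).isSome ∧
            M = D.Mmat (mdStrat (Function.update β₀ s m)) a}) := by
  have key : D.Mmat α' a =
      D.Mmat (mdStrat β₀) a +
        ∑ s : S,
          (-(D.Mmat (mdStrat β₀) a) +
            ∑ m ∈ Finset.univ.filter (fun m => (D.phi s m).isSome),
              α' s m • D.Mmat (mdStrat (Function.update β₀ s m)) a) := by
    ext u t
    rw [Matrix.add_apply, Matrix.sum_apply]
    simp only [neg_mmat_add_sum_update_apply hα', Finset.sum_ite_eq, Finset.mem_univ, if_true]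
    ring
  refine ⟨key, ?_⟩
  rw [key]
  have hmem := Submodule.subset_span (R := ℝ)
    (s := {D.Mmat (mdStrat β₀) a} ∪
      {M | ∃ s m, (D.phi s m).isSome ∧ M = D.Mmat (mdStrat (Function.update β₀ s m)) a})
  have hbase := hmem (Or.inl rfl)
  refine add_mem hbase (sum_mem fun s _ => add_mem (neg_mem hbase) (sum_mem fun m hm => ?_))
  exact Submodule.smul_mem _ _ (hmem (Or.inr ⟨s, m, (Finset.mem_filter.mp hm).2, rfl⟩))

end MDP
end

section
/- Let M = (S, L, τ, ℓ) be a labelled Markov chain with states S = {1,…,n}, and let μ and ν be subdistributions on S. Then |μ·M(w)| = |ν·M(w)| holds for all words w ∈ L* if and only if there exists a matrix F ∈ ℝ^{n×n} such that the first row of F equals μ − ν, F·1 = 0, and for each label a ∈ L there exists a matrix B(a) ∈ ℝ^{n×n} with F·M(a) = B(a)·F. -/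
open Matrix

/-- A labelled Markov chain: a transition function `τ : S → S → ℝ` and a
labelling function `ℓ : S → L`. -/
structure LMC (S L : Type) where
  tau : S → S → ℝ
  label : S → L

namespace LMC

variable {S L : Type} [Fintype S] [DecidableEq S] [DecidableEq L]

/-- The transition function is a probability distribution in each state. -/
def IsValid (M : LMC S L) : Prop :=
  (∀ s t, 0 ≤ M.tau s t) ∧ ∀ s, (∑ t, M.tau s t) = 1

/-- The matrix `M(a)`. -/
def Mmat (M : LMC S L) (a : L) : Matrix S S ℝ :=
  Matrix.of fun s t => if M.label s = a then M.tau s t else 0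

/-- The matrix `M(w)` for a word `w ∈ L*` (identity for the empty word). -/
def Mword (M : LMC S L) (w : List L) : Matrix S S ℝ :=
  (w.map M.Mmat).prod

end LMC

namespace LMC

variable {S L : Type} [Fintype S] [DecidableEq S] [DecidableEq L]

/-- The row vectors `x` with `|x·M(w)| = 0` for every word `w`. -/
def nullRows (M : LMC S L) : Submodule ℝ (S → ℝ) where
  carrier := {x | ∀ w : List L, x ᵥ* M.Mword w ⬝ᵥ 1 = 0}
  zero_mem' := by simp
  add_mem' hx hy w := by simp [add_vecMul, add_dotProduct, hx w, hy w]
  smul_mem' c x hx w := by simp [smul_vecMul, smul_dotProduct, hx w]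

theorem mem_nullRows {M : LMC S L} {x : S → ℝ} :
    x ∈ M.nullRows ↔ ∀ w : List L, x ᵥ* M.Mword w ⬝ᵥ 1 = 0 :=
  Iff.rfl

theorem vecMul_mem_nullRows {M : LMC S L} {x : S → ℝ} (hx : x ∈ M.nullRows) (a : L) :
    x ᵥ* M.Mmat a ∈ M.nullRows := fun w => by
  simpa [Mword, vecMul_vecMul] using hx (a :: w)

theorem sub_mem_nullRows_iff {M : LMC S L} {μ ν : S → ℝ} :
    μ - ν ∈ M.nullRows ↔
      ∀ w : List L, (∑ t, (M.Mword w).vecMul μ t) = ∑ t, (M.Mword w).vecMul ν t := by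
  simp [mem_nullRows, sub_vecMul, dotProduct_one, sub_eq_zero]

theorem exists_mul_Mword_eq_mul {M : LMC S L} {F : Matrix S S ℝ}
    (hF : ∀ a : L, ∃ B : Matrix S S ℝ, F * M.Mmat a = B * F) (w : List L) :
    ∃ B : Matrix S S ℝ, F * M.Mword w = B * F := by
  induction w with
  | nil => exact ⟨1, by simp [Mword]⟩
  | cons a w ih =>
    obtain ⟨A, hA⟩ := hF a
    obtain ⟨B, hB⟩ := ih
    refine ⟨A * B, ?_⟩
    have hcons : M.Mword (a :: w) = M.Mmat a * M.Mword w := by simp [Mword]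
    rw [hcons, ← Matrix.mul_assoc, hA, Matrix.mul_assoc, hB, Matrix.mul_assoc]

theorem row_mem_nullRows {M : LMC S L} {F : Matrix S S ℝ} (hF₁ : F *ᵥ 1 = 0)
    (hF : ∀ a : L, ∃ B : Matrix S S ℝ, F * M.Mmat a = B * F) (i : S) :
    F i ∈ M.nullRows := fun w => by
  obtain ⟨B, hB⟩ := exists_mul_Mword_eq_mul hF w
  have h : (F * M.Mword w) *ᵥ 1 = 0 := by rw [hB, ← mulVec_mulVec, hF₁, mulVec_zero]
  exact congrFun h i

end LMC

theorem LinearEquiv.exists_apply_eq_of_ne_zero {K E : Type*} [Field K] [AddCommGroup E]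
    [Module K E] [FiniteDimensional K E] {x y : E} (hx : x ≠ 0) (hy : y ≠ 0) :
    ∃ g : E ≃ₗ[K] E, g x = y := by
  obtain ⟨g, hg⟩ := Submodule.exists_linearEquiv_restrict_eq
    ((LinearEquiv.toSpanNonzeroSingleton K E x hx).symm ≪≫ₗ
      LinearEquiv.toSpanNonzeroSingleton K E y hy)
  have hx₁ : (LinearEquiv.toSpanNonzeroSingleton K E x hx).symm
      ⟨x, Submodule.mem_span_singleton_self x⟩ = 1 := LinearEquiv.coord_self K E x hx
  exact ⟨g, by simpa [hx₁] using (hg ⟨x, Submodule.mem_span_singleton_self x⟩).symm⟩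

theorem Submodule.exists_isProj {K E : Type*} [Field K] [AddCommGroup E] [Module K E]
    (V : Submodule K E) : ∃ p : E →ₗ[K] E, LinearMap.IsProj V p := by
  obtain ⟨q, hq⟩ := V.subtype.exists_leftInverse_of_injective V.ker_subtype
  exact ⟨V.subtype ∘ₗ q, fun x => (q x).2,
    fun x hx => congrArg V.subtype (LinearMap.congr_fun hq ⟨x, hx⟩)⟩

/-- A vector `v` of a subspace `V` of row vectors, stable under every matrix of a family `A`, is
a prescribed row of a square matrix `F` with rows in `V` whose row space is stable under `A`. -/
theorem Matrix.exists_row_eq_and_mul_eq_mul {K S ι : Type*} [Field K] [Fintype S] [DecidableEq S]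
    (A : ι → Matrix S S K) (V : Submodule K (S → K))
    (hV : ∀ a, ∀ x ∈ V, x ᵥ* A a ∈ V) {v : S → K} (hv : v ∈ V) (i : S) :
    ∃ F : Matrix S S K, F i = v ∧ (∀ j, F j ∈ V) ∧
      ∀ a, ∃ B : Matrix S S K, F * A a = B * F := by
  rcases eq_or_ne v 0 with rfl | hv₀
  · exact ⟨0, rfl, fun j => V.zero_mem, fun a => ⟨0, by simp⟩⟩
  obtain ⟨g, hg⟩ : ∃ g : (S → K) ≃ₗ[K] (S → K), g (Pi.single i 1) = v :=
    LinearEquiv.exists_apply_eq_of_ne_zero (by simp) hv₀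
  obtain ⟨p, hp⟩ := V.exists_isProj
  have hrow (f : (S → K) →ₗ[K] (S → K)) (x : S → K) : x ᵥ* f.toMatrixRight' = f x :=
    LinearMap.congr_fun (LinearMap.toMatrixRight'.symm_apply_apply f) x
  set F : Matrix S S K := (p ∘ₗ g.toLinearMap).toMatrixRight'
  have hF (x : S → K) : x ᵥ* F = p (g x) := hrow _ x
  have hFj (j : S) : F j = p (g (Pi.single j 1)) := by
    rw [← hF, single_one_vecMul]; rfl
  refine ⟨F, ?_, fun j => ?_, fun a => ?_⟩
  · rw [hFj, hg, hp.map_id v hv]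
  · rw [hFj]; exact hp.map_mem _
  · let b : (S → K) →ₗ[K] (S → K) :=
      g.symm.toLinearMap ∘ₗ (A a).vecMulLinear ∘ₗ p ∘ₗ g.toLinearMap
    refine ⟨b.toMatrixRight', Matrix.ext_of_single_vecMul fun j => ?_⟩
    rw [← vecMul_vecMul, ← vecMul_vecMul, hF, hF, hrow]
    simp [b, hp.map_id _ (hV a _ (hp.map_mem _))]

/-- for a labelled Markov chain with states `{1,…,n}` and
subdistributions `μ, ν`, one has `|μ·M(w)| = |ν·M(w)|` for all words `w ∈ L*` iff
there is a matrix `F` whose first row is `μ − ν`, with `F·1 = 0`, and such that for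
every label `a` there is a matrix `B(a)` with `F·M(a) = B(a)·F`. -/
theorem lmc_equiv_iff_exists_F
    {L : Type} [Fintype L] [DecidableEq L] (n : ℕ) (hn : 1 ≤ n)
    (M : LMC (Fin n) L) (hM : M.IsValid)
    (μ ν : Fin n → ℝ)
    (hμ : (∀ s, 0 ≤ μ s) ∧ (∀ s, μ s ≤ 1) ∧ 0 < (∑ s, μ s) ∧ (∑ s, μ s) ≤ 1)
    (hν : (∀ s, 0 ≤ ν s) ∧ (∀ s, ν s ≤ 1) ∧ 0 < (∑ s, ν s) ∧ (∑ s, ν s) ≤ 1) :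
    (∀ w : List L, (∑ t, (M.Mword w).vecMul μ t) = ∑ t, (M.Mword w).vecMul ν t) ↔
      ∃ F : Matrix (Fin n) (Fin n) ℝ,
        F ⟨0, hn⟩ = μ - ν ∧
        F.mulVec 1 = 0 ∧
        ∀ a : L, ∃ B : Matrix (Fin n) (Fin n) ℝ, F * M.Mmat a = B * F := by
  rw [← LMC.sub_mem_nullRows_iff]
  constructor
  · intro h
    obtain ⟨F, hF₀, hF₁, hF⟩ := Matrix.exists_row_eq_and_mul_eq_mul M.Mmat M.nullRows
      (fun a x hx => LMC.vecMul_mem_nullRows hx a) h ⟨0, hn⟩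
    refine ⟨F, hF₀, funext fun j => ?_, hF⟩
    simpa [LMC.Mword, mulVec] using hF₁ j []
  · rintro ⟨F, hF₀, hF₁, hF⟩
    exact hF₀ ▸ LMC.row_mem_nullRows hF₁ hF ⟨0, hn⟩
end
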